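/- (Determinants of even-indexed Betti minors.) For k ≥ 1 let 𝔅_k^e := ( (𝔅_k)_{2a,2b} )_{1≤a,b≤⌊k/2⌋} be the minor of 𝔅_k on even-numbered rows and columns (an empty matrix has determinant 1). Then for every m ≥ 1: det 𝔅_{2m−1}^e = (−1)^{m+1}·2^{(5−4m)m}·( ∏_{n=1}^{2m−1} (2n−1)! ) / ( (2m−1)!!·(4m−2)!! ), and det 𝔅_{2m}^e = (−1)^m·2^{−m(4m+1)}·((2m)!!/(4m)!!)·∏_{n=1}^{2m} (2n−1)!. -/

import Mathlib

open scoped BigOperators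
open Matrix Polynomial Filter


/-- Entry `(a,b)` (1-based) of the Betti matrix `𝔅_k`. -/
noncomputable def BettiEntry (k a b : ℕ) : ℚ :=
  ((-1 : ℚ) ^ (a + 1) / 2 ^ (2 * k + 2)) *
    (((2 * k + 1 - a).factorial : ℚ) * ((2 * k + 1 - b).factorial : ℚ) /
      ((2 * k + 2 - a - b).factorial : ℚ)) *
    _root_.bernoulli (2 * k + 2 - a - b) / (-1 : ℚ) ^ ((2 * k + 1 - a - b) / 2)

namespace BettiAux

/-- Bessel-type series: `φ_n(y) = ∑ 2^n (n+j)!/(j! (2n+2j+1)!) y^j`. -/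
noncomputable def phi (n : ℕ) : PowerSeries ℚ :=
  PowerSeries.mk fun j =>
    (2 : ℚ) ^ n * ((n + j).factorial : ℚ) / ((j.factorial : ℚ) * ((2 * n + 2 * j + 1).factorial : ℚ))

/-- Normalised even Bernoulli numbers. -/
noncomputable def hh (n : ℕ) : ℚ :=
  (4 : ℚ) ^ (n + 1) * _root_.bernoulli (2 * n + 2) / ((2 * n + 2).factorial : ℚ)

/-- Generating series of `hh`. -/
noncomputable def psi : PowerSeries ℚ := PowerSeries.mk hh

lemma phi_rec (n : ℕ) :
    phi n = (2 * (n : ℚ) + 3) • phi (n + 1) + PowerSeries.X * phi (n + 2) := by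
  ext j
  rcases j with _ | j
  · simp only [phi, map_add, PowerSeries.coeff_smul, PowerSeries.coeff_mk,
      PowerSeries.coeff_zero_X_mul, smul_eq_mul]
    have h1 : 2 * (n + 1) + 2 * 0 + 1 = (2 * n + 1) + 1 + 1 := by ring
    have h2 : n + 1 + 0 = n + 1 := by ring
    rw [h1, h2]
    simp only [Nat.factorial_succ, add_zero, mul_zero]
    push_cast
    have := Nat.factorial_ne_zero (2 * n)
    field_simp
    ring
  · simp only [phi, map_add, PowerSeries.coeff_smul, PowerSeries.coeff_mk,
      PowerSeries.coeff_succ_X_mul, smul_eq_mul]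
    have h1 : 2 * (n + 1) + 2 * (j + 1) + 1 = (2 * n + 2 * j + 2) + 1 + 1 + 1 := by ring
    have h2 : 2 * (n + 2) + 2 * j + 1 = (2 * n + 2 * j + 2) + 1 + 1 + 1 := by ring
    have h3 : 2 * n + 2 * (j + 1) + 1 = (2 * n + 2 * j + 2) + 1 := by ring
    have h4 : n + 1 + (j + 1) = (n + j + 1) + 1 := by ring
    have h5 : n + 2 + j = (n + j + 1) + 1 := by ring
    have h6 : n + (j + 1) = (n + j + 1) := by ring
    rw [h1, h2, h3, h4, h5, h6, Nat.factorial_succ (n + j + 1), Nat.factorial_succ j,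
      Nat.factorial_succ (2 * n + 2 * j + 2 + 1 + 1), Nat.factorial_succ (2 * n + 2 * j + 2 + 1)]
    have a1 := Nat.factorial_ne_zero (2 * n + 2 * j + 2 + 1)
    have a2 := Nat.factorial_ne_zero j
    have a3 := Nat.factorial_ne_zero (n + j + 1)
    push_cast
    field_simp
    ring

lemma sum_range_even_odd (f : ℕ → ℚ) (n : ℕ) :
    ∑ i ∈ Finset.range (2 * n), f i = ∑ i ∈ Finset.range n, (f (2 * i) + f (2 * i + 1)) := by
  induction n with
  | zero => simp
  | succ n ih => rw [mul_add, mul_one, Finset.sum_range_succ, Finset.sum_range_succ, ih,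
      Finset.sum_range_succ]; ring

lemma bern_series :
    PowerSeries.rescale (2 : ℚ) (bernoulliPowerSeries ℚ) *
      (PowerSeries.exp ℚ - PowerSeries.evalNegHom (PowerSeries.exp ℚ)) =
    2 * (PowerSeries.X * PowerSeries.evalNegHom (PowerSeries.exp ℚ)) := by
  have h := congrArg (PowerSeries.rescale (2 : ℚ)) (bernoulliPowerSeries_mul_exp_sub_one ℚ)
  have h2 := PowerSeries.exp_pow_eq_rescale_exp (A := ℚ) 2
  have h3 := PowerSeries.exp_mul_exp_neg_eq_one (A := ℚ)
  have hX : PowerSeries.rescale (2 : ℚ) PowerSeries.X = 2 * (PowerSeries.X : PowerSeries ℚ) := by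
    rw [PowerSeries.rescale_X]; rfl
  push_cast at h2
  rw [map_mul, map_sub, map_one, ← h2, hX] at h
  linear_combination (PowerSeries.evalNegHom (PowerSeries.exp ℚ)) * h -
    (PowerSeries.rescale (2 : ℚ) (bernoulliPowerSeries ℚ)) * (PowerSeries.exp ℚ) * h3

lemma psi_mul_phi : psi * phi 0 = phi 1 := by
  ext n
  have h := congrArg (PowerSeries.coeff (2 * n + 3)) bern_series
  have e2 : (2 : PowerSeries ℚ) = PowerSeries.C (2 : ℚ) := rfl
  rw [e2, PowerSeries.coeff_C_mul, PowerSeries.coeff_succ_X_mul, PowerSeries.coeff_mul,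
    Finset.Nat.sum_antidiagonal_eq_sum_range_succ_mk,
    show (2 * n + 3).succ = 2 * (n + 2) by omega, sum_range_even_odd,
    Finset.sum_range_succ'] at h
  rw [PowerSeries.coeff_mul, Finset.Nat.sum_antidiagonal_eq_sum_range_succ_mk]
  simp only [PowerSeries.evalNegHom, map_sub, PowerSeries.coeff_rescale, PowerSeries.coeff_exp,
    bernoulliPowerSeries, PowerSeries.coeff_mk, eq_ratCast, Rat.cast_id] at h
  have key : ∀ i ∈ Finset.range (n + 1), PowerSeries.coeff i psi * PowerSeries.coeff (n - i) (phi 0)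
      = (1/2) * ((2:ℚ) ^ (2 * (i + 1)) * (_root_.bernoulli (2 * (i + 1)) / ((2 * (i + 1)).factorial : ℚ)) *
      (1 / ((2 * n + 3 - 2 * (i + 1)).factorial : ℚ) - (-1) ^ (2 * n + 3 - 2 * (i + 1)) *
        (1 / ((2 * n + 3 - 2 * (i + 1)).factorial : ℚ))) +
      (2:ℚ) ^ (2 * (i + 1) + 1) * (_root_.bernoulli (2 * (i + 1) + 1) / ((2 * (i + 1) + 1).factorial : ℚ)) *
      (1 / ((2 * n + 3 - (2 * (i + 1) + 1)).factorial : ℚ) - (-1) ^ (2 * n + 3 - (2 * (i + 1) + 1)) *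
        (1 / ((2 * n + 3 - (2 * (i + 1) + 1)).factorial : ℚ)))) := by
    intro i hi
    obtain ⟨d, rfl⟩ : ∃ d, n = i + d := ⟨n - i, by have := Finset.mem_range.1 hi; omega⟩
    have a1 : 2 * (i + d) + 3 - 2 * (i + 1) = 2 * d + 1 := by omega
    have a2 : 2 * (i + d) + 3 - (2 * (i + 1) + 1) = 2 * d := by omega
    have a3 : i + d - i = d := by omega
    rw [a1, a2, a3]
    simp only [psi, phi, PowerSeries.coeff_mk, hh, pow_add, pow_mul]
    norm_num
    have := Nat.factorial_ne_zero d
    simp only [mul_add, mul_one]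
    field_simp
    ring
  rw [Finset.sum_congr rfl key, ← Finset.mul_sum]
  have hb0 : _root_.bernoulli 0 = 1 := bernoulli_zero
  have o1 : (-1 : ℚ) ^ (2 * n + 3) = -1 := by rw [pow_add, pow_mul]; norm_num
  have o2 : (-1 : ℚ) ^ (2 * n + 2) = 1 := by rw [pow_add, pow_mul]; norm_num
  have hz1 : 2 * n + 3 - 2 * 0 = 2 * n + 3 := by omega
  have hz2 : 2 * n + 3 - (2 * 0 + 1) = 2 * n + 2 := by omega
  rw [hz1, hz2, o1, o2] at h
  have h' := eq_sub_of_add_eq h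
  rw [h']
  simp only [phi, PowerSeries.coeff_mk]
  have b1 : 2 * 1 + 2 * n + 1 = 2 * n + 2 + 1 := by ring
  have b2 : 1 + n = n + 1 := by ring
  have b3 : 2 * n + 3 = 2 * n + 2 + 1 := by ring
  rw [b1, b2, b3, Nat.factorial_succ (2 * n + 2), Nat.factorial_succ n]
  have := Nat.factorial_ne_zero n
  have := Nat.factorial_ne_zero (2 * n + 2)
  push_cast
  simp
  field_simp
  ring

/-- Numerator recursion. -/
noncomputable def pp : ℕ → PowerSeries ℚ
  | 0 => 1
  | 1 => -(3 : ℚ) • 1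
  | n + 2 => PowerSeries.X * pp n - (2 * (n : ℚ) + 5) • pp (n + 1)

/-- Denominator recursion. -/
noncomputable def qq : ℕ → PowerSeries ℚ
  | 0 => 0
  | 1 => 1
  | n + 2 => PowerSeries.X * qq n - (2 * (n : ℚ) + 5) • qq (n + 1)

lemma pp_qq : ∀ n, PowerSeries.X ^ n * phi (n + 1) = pp n * phi 1 + qq n * phi 0
  | 0 => by simp [pp, qq]
  | 1 => by
      have := phi_rec 0
      simp only [pp, qq, PowerSeries.smul_eq_C_mul] at *
      simp at this ⊢
      rw [this]; ring
  | n + 2 => by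
      have h0 := pp_qq n
      have h1 := pp_qq (n + 1)
      have h := phi_rec (n + 1)
      simp only [pp, qq, PowerSeries.smul_eq_C_mul] at *
      have e : (2 * ((n + 1 : ℕ) : ℚ) + 3) = 2 * (n : ℚ) + 5 := by push_cast; ring
      rw [e] at h
      linear_combination PowerSeries.X * h0 - PowerSeries.C (2 * (n : ℚ) + 5) * h1 -
        PowerSeries.X ^ (n + 1) * h

lemma pp_coeff : ∀ n j, n < 2 * j → PowerSeries.coeff j (pp n) = 0
  | 0, j, h => by
      simp only [pp, PowerSeries.coeff_one]; rw [if_neg]; omega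
  | 1, j, h => by
      simp only [pp, PowerSeries.coeff_smul, PowerSeries.coeff_one]; rw [if_neg (by omega)]; simp
  | n + 2, j, h => by
      obtain ⟨j, rfl⟩ : ∃ i, j = i + 1 := ⟨j - 1, by omega⟩
      simp only [pp, map_sub, PowerSeries.coeff_smul, PowerSeries.coeff_succ_X_mul]
      rw [pp_coeff n j (by omega), pp_coeff (n + 1) (j + 1) (by omega)]; simp

lemma qq_coeff : ∀ n j, n ≤ 2 * j → PowerSeries.coeff j (qq n) = 0
  | 0, j, h => by simp [qq]
  | 1, j, h => by
      simp only [qq, PowerSeries.coeff_one]; rw [if_neg]; omega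
  | n + 2, j, h => by
      obtain ⟨j, rfl⟩ : ∃ i, j = i + 1 := ⟨j - 1, by omega⟩
      simp only [qq, map_sub, PowerSeries.coeff_smul, PowerSeries.coeff_succ_X_mul]
      rw [qq_coeff n j (by omega), qq_coeff (n + 1) (j + 1) (by omega)]; simp

lemma pp_zero : ∀ n, PowerSeries.coeff 0 (pp n) = (-1) ^ n * (Nat.doubleFactorial (2 * n + 1) : ℚ)
  | 0 => by simp [pp]
  | 1 => by
      simp only [pp, PowerSeries.coeff_smul, PowerSeries.coeff_one]
      norm_num [Nat.doubleFactorial]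
  | n + 2 => by
      simp only [pp, map_sub, PowerSeries.coeff_smul, PowerSeries.coeff_zero_X_mul]
      rw [pp_zero (n + 1), show 2 * (n + 2) + 1 = (2 * (n + 1) + 1) + 2 by ring,
        Nat.doubleFactorial_add_two]
      push_cast
      simp only [smul_eq_mul]
      ring

lemma phi_zero (n : ℕ) :
    PowerSeries.coeff 0 (phi n) = 1 / (Nat.doubleFactorial (2 * n + 1) : ℚ) := by
  simp only [phi, PowerSeries.coeff_mk, add_zero, mul_zero]
  rw [Nat.factorial_eq_mul_doubleFactorial, Nat.doubleFactorial_two_mul]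
  have := Nat.factorial_ne_zero n
  have := (Nat.doubleFactorial_pos (2 * n + 1)).ne'
  push_cast
  simp
  field_simp

lemma pp_psi_coeff (n i : ℕ) (h1 : n ≤ 2 * i) (h2 : i ≤ n) :
    PowerSeries.coeff i (pp n * psi) =
      if i = n then 1 / (Nat.doubleFactorial (2 * n + 3) : ℚ) else 0 := by
  have hc : PowerSeries.constantCoeff (phi 0) = 1 := by
    rw [← PowerSeries.coeff_zero_eq_constantCoeff_apply, phi_zero]; simp
  have hi : phi 0 * (phi 0)⁻¹ = 1 := PowerSeries.mul_inv_cancel _ (by rw [hc]; simp)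
  have h := pp_qq n
  rw [← psi_mul_phi] at h
  have e : pp n * psi = PowerSeries.X ^ n * (phi (n + 1) * (phi 0)⁻¹) - qq n := by
    linear_combination (-(phi 0)⁻¹) * h - (pp n * psi + qq n) * hi
  rw [e, map_sub, qq_coeff n i h1, PowerSeries.coeff_X_pow_mul']
  rcases eq_or_ne i n with rfl | hne
  · simp only [le_refl, if_true, Nat.sub_self, sub_zero]
    have := phi_zero (i + 1)
    rw [PowerSeries.coeff_zero_eq_constantCoeff_apply] at this ⊢
    rw [map_mul, this, PowerSeries.constantCoeff_inv, hc, show 2 * (i + 1) + 1 = 2 * i + 3 by ring]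
    simp
  · rw [if_neg (by omega), if_neg hne]; simp

lemma hankel_det (σ : ℕ) (hσ : σ ≤ 1) (N : ℕ) :
    Matrix.det (Matrix.of fun i j : Fin N => hh ((i : ℕ) + j + σ)) =
      ∏ i ∈ Finset.range N, ((-1 : ℚ) ^ σ / ((Nat.doubleFactorial (4 * i + 2 * σ + 1) : ℚ) *
        (Nat.doubleFactorial (4 * i + 2 * σ + 3) : ℚ))) := by
  set H := Matrix.of fun i j : Fin N => hh ((i : ℕ) + j + σ) with hH
  let U : Matrix (Fin N) (Fin N) ℚ := Matrix.of fun j r : Fin N =>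
    if (j : ℕ) ≤ r then PowerSeries.coeff ((r : ℕ) - j) (pp (2 * r + σ)) else 0
  have hU : U.det = ∏ i : Fin N, ((-1 : ℚ) ^ σ * (Nat.doubleFactorial (4 * i + 2 * σ + 1) : ℚ)) := by
    rw [Matrix.det_of_isUpperTriangular]
    · refine Finset.prod_congr rfl fun i _ => ?_
      simp only [U, Matrix.of_apply, le_refl, if_true, Nat.sub_self]
      rw [pp_zero, pow_add, pow_mul, show 2 * (2 * (i : ℕ) + σ) + 1 = 4 * i + 2 * σ + 1 by ring]
      simp
    · intro i j hij
      have hij' : (j : ℕ) < i := hij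
      simp only [U, Matrix.of_apply]
      rw [if_neg (by omega)]
  have hent : ∀ s r : Fin N, (s : ℕ) ≤ r → (H * U) s r =
      if (s : ℕ) = r then 1 / (Nat.doubleFactorial (4 * r + 2 * σ + 3) : ℚ) else 0 := by
    intro s r hsr
    have h := pp_psi_coeff (2 * r + σ) (r + σ + s) (by omega) (by omega)
    rw [PowerSeries.coeff_mul, Finset.Nat.sum_antidiagonal_eq_sum_range_succ_mk] at h
    have e1 : (((r : ℕ) + σ + s = 2 * r + σ)) ↔ ((s : ℕ) = r) := by omega
    simp only [e1, show 2 * (2 * (r : ℕ) + σ) + 3 = 4 * r + 2 * σ + 3 by ring] at h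
    rw [← h, Matrix.mul_apply]
    simp only [hH, U, Matrix.of_apply]
    rw [Fin.sum_univ_eq_sum_range (fun j => hh ((s : ℕ) + j + σ) *
      (if j ≤ (r : ℕ) then PowerSeries.coeff ((r : ℕ) - j) (pp (2 * r + σ)) else 0)) N]
    have hN : N = (r + 1) + (N - (r + 1)) := by have := r.2; omega
    have hR : Finset.range N = Finset.range ((r + 1) + (N - (r + 1))) := congrArg _ hN
    rw [hR, Finset.sum_range_add, Finset.sum_eq_zero (s := Finset.range (N - (r + 1))), add_zero]
    · rw [show ((r : ℕ) + σ + s).succ = (r + 1) + (σ + s) by omega,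
        Finset.sum_range_add _ (r + 1) (σ + s),
        Finset.sum_eq_zero (s := Finset.range (σ + s)), add_zero, ← Finset.sum_range_reflect]
      · refine Finset.sum_congr rfl fun j hj => ?_
        have hj' := Finset.mem_range.1 hj
        rw [if_pos (by omega), show (r : ℕ) - (r + 1 - 1 - j) = j by omega, psi,
          PowerSeries.coeff_mk, show (s : ℕ) + (r + 1 - 1 - j) + σ = r + σ + s - j by omega, mul_comm]
      · intro x _
        rw [pp_coeff _ _ (by omega), zero_mul]
    · intro x _
      rw [if_neg (by omega), mul_zero]
  have hL : (H * U).det = ∏ i : Fin N, (1 / (Nat.doubleFactorial (4 * i + 2 * σ + 3) : ℚ)) := by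
    rw [Matrix.det_of_isLowerTriangular]
    · refine Finset.prod_congr rfl fun i _ => ?_
      rw [hent i i le_rfl]; simp
    · intro i j hij
      have hij' : (i : ℕ) < j := hij
      rw [hent i j hij'.le, if_neg (by omega)]
  rw [Matrix.det_mul, hU] at hL
  have hs : ((-1 : ℚ) ^ σ) * (-1) ^ σ = 1 := by rw [← mul_pow]; simp
  have hne : ∏ i : Fin N, ((-1 : ℚ) ^ σ * (Nat.doubleFactorial (4 * i + 2 * σ + 1) : ℚ)) ≠ 0 := by
    refine Finset.prod_ne_zero_iff.2 fun i _ => ?_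
    have := (Nat.doubleFactorial_pos (4 * i + 2 * σ + 1)).ne'
    refine mul_ne_zero (by simp) (by exact_mod_cast this)
  rw [← mul_left_inj' hne, hL, ← Fin.prod_univ_eq_prod_range (fun i =>
    ((-1 : ℚ) ^ σ / ((Nat.doubleFactorial (4 * i + 2 * σ + 1) : ℚ) *
        (Nat.doubleFactorial (4 * i + 2 * σ + 3) : ℚ)))) N, ← Finset.prod_mul_distrib]
  refine Finset.prod_congr rfl fun i _ => ?_
  have a1 := (Nat.doubleFactorial_pos (4 * i + 2 * σ + 1)).ne'
  have a2 := (Nat.doubleFactorial_pos (4 * i + 2 * σ + 3)).ne'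
  field_simp
  rw [pow_two, hs]

lemma entry_eq (σ N : ℕ) (i j : ℕ) (hi : i < N) (hj : j < N) :
    BettiEntry (2 * N + σ) (2 * (N - 1 - i + 1)) (2 * (N - 1 - j + 1)) =
      (-(-1 : ℚ) ^ σ / 2 ^ (4 * N + 2 * σ + 2) * (-1) ^ i / 4 ^ (i + σ + 1) *
        ((2 * N + 2 * σ + 1 + 2 * i).factorial : ℚ)) *
      (((-1) ^ j / 4 ^ j * ((2 * N + 2 * σ + 1 + 2 * j).factorial : ℚ)) * hh (i + j + σ)) := by
  unfold BettiEntry hh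
  have e1 : 2 * (2 * N + σ) + 1 - 2 * (N - 1 - i + 1) = 2 * N + 2 * σ + 1 + 2 * i := by omega
  have e2 : 2 * (2 * N + σ) + 1 - 2 * (N - 1 - j + 1) = 2 * N + 2 * σ + 1 + 2 * j := by omega
  have e3 : 2 * (2 * N + σ) + 2 - 2 * (N - 1 - i + 1) - 2 * (N - 1 - j + 1) =
    2 * (i + j + σ) + 2 := by omega
  have e4 : (2 * (2 * N + σ) + 1 - 2 * (N - 1 - i + 1) - 2 * (N - 1 - j + 1)) / 2 =
    i + j + σ := by omega
  have e5 : 2 * (2 * N + σ) + 2 = 4 * N + 2 * σ + 2 := by ring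
  rw [e4, e3, e2, e1, e5]
  have s : ∀ n : ℕ, ((-1 : ℚ) ^ n)⁻¹ = (-1) ^ n := fun n => by
    rw [← inv_pow]; norm_num
  have s1 : (-1 : ℚ) ^ (2 * (N - 1 - i + 1) + 1) = -1 := by rw [pow_succ, pow_mul]; norm_num
  rw [s1, div_eq_mul_inv _ ((-1 : ℚ) ^ (i + j + σ)), s]
  have f1 := Nat.factorial_ne_zero (2 * (i + j + σ) + 2)
  field_simp
  ring

lemma det_eq (σ : ℕ) (hσ : σ ≤ 1) (N : ℕ) :
    Matrix.det (Matrix.of fun a b : Fin N =>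
      BettiEntry (2 * N + σ) (2 * ((a : ℕ) + 1)) (2 * ((b : ℕ) + 1))) =
    ∏ i ∈ Finset.range N, (-1 / 2 ^ (4 * N + 2 * σ + 2) / 4 ^ (2 * i + σ + 1) *
      ((2 * N + 2 * σ + 1 + 2 * i).factorial : ℚ) ^ 2 /
      ((Nat.doubleFactorial (4 * i + 2 * σ + 1) : ℚ) *
        (Nat.doubleFactorial (4 * i + 2 * σ + 3) : ℚ))) := by
  rw [← Matrix.det_submatrix_equiv_self (Fin.revPerm)]
  have e : (Matrix.of fun a b : Fin N =>
      BettiEntry (2 * N + σ) (2 * ((a : ℕ) + 1)) (2 * ((b : ℕ) + 1))).submatrix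
        Fin.revPerm Fin.revPerm =
      Matrix.of fun i j : Fin N => (-(-1 : ℚ) ^ σ / 2 ^ (4 * N + 2 * σ + 2) * (-1) ^ (i : ℕ) /
        4 ^ ((i : ℕ) + σ + 1) * ((2 * N + 2 * σ + 1 + 2 * (i : ℕ)).factorial : ℚ)) *
      (Matrix.of (fun i j : Fin N =>
        ((-1) ^ (j : ℕ) / 4 ^ (j : ℕ) * ((2 * N + 2 * σ + 1 + 2 * (j : ℕ)).factorial : ℚ)) *
        (Matrix.of fun i j : Fin N => hh ((i : ℕ) + j + σ)) i j)) i j := by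
    ext i j
    simp only [Matrix.submatrix_apply, Matrix.of_apply, Fin.revPerm_apply, Fin.val_rev]
    rw [← entry_eq σ N i j i.2 j.2]
    congr 2 <;> omega
  rw [e, Matrix.det_mul_column, Matrix.det_mul_row, hankel_det σ hσ,
    Fin.prod_univ_eq_prod_range (fun i => (-(-1 : ℚ) ^ σ / 2 ^ (4 * N + 2 * σ + 2) * (-1) ^ i /
        4 ^ (i + σ + 1) * ((2 * N + 2 * σ + 1 + 2 * i).factorial : ℚ))) N,
    Fin.prod_univ_eq_prod_range (fun j =>
        ((-1) ^ j / 4 ^ j * ((2 * N + 2 * σ + 1 + 2 * j).factorial : ℚ))) N,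
    ← Finset.prod_mul_distrib, ← Finset.prod_mul_distrib]
  refine Finset.prod_congr rfl fun i _ => ?_
  have hs : ((-1 : ℚ) ^ σ) ^ 2 = 1 := by rw [← pow_mul, mul_comm, pow_mul]; simp
  have hi : ((-1 : ℚ) ^ i) ^ 2 = 1 := by rw [← pow_mul, mul_comm, pow_mul]; simp
  have a1 := (Nat.doubleFactorial_pos (4 * i + 2 * σ + 1)).ne'
  have a2 := (Nat.doubleFactorial_pos (4 * i + 2 * σ + 3)).ne'
  field_simp
  rw [hs, hi]
  ring

/-- Product of odd factorials. -/
def AA (n : ℕ) : ℕ := ∏ i ∈ Finset.range n, (2 * i + 1).factorial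

/-- Product of double factorials. -/
def DD (σ n : ℕ) : ℕ := ∏ i ∈ Finset.range n,
  (Nat.doubleFactorial (4 * i + 2 * σ + 1) * Nat.doubleFactorial (4 * i + 2 * σ + 3))

lemma AA_pos (n : ℕ) : AA n ≠ 0 := Finset.prod_ne_zero_iff.2 fun _ _ => Nat.factorial_ne_zero _

lemma DD_pos (σ n : ℕ) : DD σ n ≠ 0 := Finset.prod_ne_zero_iff.2 fun _ _ =>
  mul_ne_zero (Nat.doubleFactorial_pos _).ne' (Nat.doubleFactorial_pos _).ne'

lemma fact_odd (n : ℕ) : (2 * n + 1).factorial =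
    Nat.doubleFactorial (2 * n + 1) * (2 ^ n * n.factorial) := by
  rw [Nat.factorial_eq_mul_doubleFactorial, Nat.doubleFactorial_two_mul]

lemma arith_even (m : ℕ) : AA (2 * m) * Nat.doubleFactorial (4 * m) =
    2 ^ (2 * m ^ 2 + m) * Nat.doubleFactorial (2 * m) * AA m ^ 2 * DD 0 m := by
  induction m with
  | zero => simp [AA, DD]
  | succ m ih =>
    have hA : AA (2 * (m + 1)) = AA (2 * m) * (2 * (2 * m) + 1).factorial *
        (2 * (2 * m + 1) + 1).factorial := by
      simp only [AA, mul_add, mul_one, Finset.prod_range_succ]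
    have hA' : AA (m + 1) = AA m * (2 * m + 1).factorial := by
      simp only [AA, Finset.prod_range_succ]
    have hD : DD 0 (m + 1) = DD 0 m * (Nat.doubleFactorial (2 * (2 * m) + 1) *
        Nat.doubleFactorial (2 * (2 * m + 1) + 1)) := by
      simp only [DD, Finset.prod_range_succ]; ring_nf
    have hd : Nat.doubleFactorial (4 * (m + 1)) =
        (4 * m + 4) * ((4 * m + 2) * Nat.doubleFactorial (4 * m)) := by
      rw [show 4 * (m + 1) = 4 * m + 2 + 2 by ring, Nat.doubleFactorial_add_two,
        Nat.doubleFactorial_add_two]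
    have hd' : Nat.doubleFactorial (2 * (m + 1)) = (2 * m + 2) * Nat.doubleFactorial (2 * m) := by
      rw [show 2 * (m + 1) = 2 * m + 2 by ring, Nat.doubleFactorial_add_two]
    rw [hA, hA', hD, hd, hd', fact_odd (2 * m), fact_odd (2 * m + 1), Nat.factorial_succ (2 * m),
      show 2 * (m + 1) ^ 2 + (m + 1) = (2 * m ^ 2 + m) + (4 * m + 3) by ring,
      pow_add 2 (2 * m ^ 2 + m) (4 * m + 3)]
    generalize Nat.doubleFactorial (2 * (2 * m) + 1) = x at *
    generalize Nat.doubleFactorial (2 * (2 * m + 1) + 1) = y at *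
    have : 2 ^ (4 * m + 3) = 8 * (2 ^ (2 * m)) ^ 2 := by ring
    rw [this, pow_succ 2 (2 * m)]
    generalize 2 ^ (2 * m) = z at *
    zify at ih ⊢
    linear_combination (x * y * z ^ 2 * 2 * (2 * m).factorial ^ 2 * (2 * m + 1) * (4 * m + 4) *
      (4 * m + 2)) * ih

lemma arith_odd (m : ℕ) :
    AA (2 * m + 1) * (Nat.doubleFactorial (2 * m + 1) * Nat.doubleFactorial (4 * m + 2)) =
    2 ^ (2 * m ^ 2 + 3 * m + 1) * AA (m + 1) ^ 2 * DD 1 m := by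
  induction m with
  | zero => simp [AA, DD, Nat.doubleFactorial]
  | succ m ih =>
    have hA : AA (2 * (m + 1) + 1) = AA (2 * m + 1) * (2 * (2 * m + 1) + 1).factorial *
        (2 * (2 * m + 2) + 1).factorial := by
      rw [show 2 * (m + 1) + 1 = 2 * m + 1 + 1 + 1 by ring]
      simp only [AA, Finset.prod_range_succ _ (2 * m + 1 + 1), Finset.prod_range_succ _ (2 * m + 1)]
    have hA' : AA (m + 1 + 1) = AA (m + 1) * (2 * m + 3).factorial := by
      simp only [AA, Finset.prod_range_succ _ (m + 1)]; ring_nf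
    have hD : DD 1 (m + 1) = DD 1 m * (Nat.doubleFactorial (2 * (2 * m + 1) + 1) *
        Nat.doubleFactorial (2 * (2 * m + 2) + 1)) := by
      simp only [DD, Finset.prod_range_succ]; ring_nf
    have hd : Nat.doubleFactorial (4 * (m + 1) + 2) =
        (4 * m + 6) * ((4 * m + 4) * Nat.doubleFactorial (4 * m + 2)) := by
      rw [show 4 * (m + 1) + 2 = 4 * m + 2 + 2 + 2 by ring, Nat.doubleFactorial_add_two,
        Nat.doubleFactorial_add_two]
    have hd' : Nat.doubleFactorial (2 * (m + 1) + 1) =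
        (2 * m + 3) * Nat.doubleFactorial (2 * m + 1) := by
      rw [show 2 * (m + 1) + 1 = 2 * m + 1 + 2 by ring, Nat.doubleFactorial_add_two]
    rw [hA, hA', hD, hd, hd', fact_odd (2 * m + 1), fact_odd (2 * m + 2),
      Nat.factorial_succ (2 * m + 2), Nat.factorial_succ (2 * m + 1),
      show 2 * (m + 1) ^ 2 + 3 * (m + 1) + 1 = (2 * m ^ 2 + 3 * m + 1) + (4 * m + 5) by ring,
      pow_add 2 (2 * m ^ 2 + 3 * m + 1) (4 * m + 5)]
    generalize Nat.doubleFactorial (2 * (2 * m + 1) + 1) = x at *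
    generalize Nat.doubleFactorial (2 * (2 * m + 2) + 1) = y at *
    have : 2 ^ (4 * m + 5) = 32 * (2 ^ (2 * m)) ^ 2 := by ring
    have p1 : 2 ^ (2 * m + 1) = 2 * 2 ^ (2 * m) := by ring
    have p2 : 2 ^ (2 * m + 2) = 4 * 2 ^ (2 * m) := by ring
    rw [this, p1, p2]
    generalize 2 ^ (2 * m) = z at *
    zify at ih ⊢
    linear_combination (x * y * z ^ 2 * 8 * (2 * m + 1).factorial ^ 2 * (2 * m + 2) * (4 * m + 4) *
      (4 * m + 6) * (2 * m + 3)) * ih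

lemma AA_split (σ N : ℕ) :
    AA (2 * N + σ) = AA (N + σ) * ∏ i ∈ Finset.range N, (2 * N + 2 * σ + 1 + 2 * i).factorial := by
  rw [AA, show 2 * N + σ = (N + σ) + N by ring, Finset.prod_range_add, AA]
  congr 1
  refine Finset.prod_congr rfl fun i _ => ?_
  congr 1; ring

lemma pow_prod (σ N : ℕ) :
    ∏ i ∈ Finset.range N, (-1 / 2 ^ (4 * N + 2 * σ + 2) / 4 ^ (2 * i + σ + 1) : ℚ) =
      (-1) ^ N / 2 ^ (6 * N ^ 2 + 2 * N + 4 * σ * N) := by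
  have h : ∀ M : ℕ, ∏ i ∈ Finset.range M, (-1 / 2 ^ (4 * N + 2 * σ + 2) / 4 ^ (2 * i + σ + 1) : ℚ) =
      (-1) ^ M / 2 ^ ((4 * N + 2 * σ + 2) * M + 2 * M ^ 2 + 2 * σ * M) := by
    intro M
    induction M with
    | zero => simp
    | succ M ih =>
      rw [Finset.prod_range_succ, ih, show (4 : ℚ) = 2 ^ 2 by norm_num, ← pow_mul, div_div,
        ← pow_add, div_mul_div_comm, ← pow_add, pow_succ (-1 : ℚ)]
      congr 2
      ring
  rw [h]; congr 2; ring

lemma det_eq' (σ : ℕ) (hσ : σ ≤ 1) (N : ℕ) :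
    Matrix.det (Matrix.of fun a b : Fin N =>
      BettiEntry (2 * N + σ) (2 * ((a : ℕ) + 1)) (2 * ((b : ℕ) + 1))) =
    (-1) ^ N / 2 ^ (6 * N ^ 2 + 2 * N + 4 * σ * N) * ((AA (2 * N + σ) : ℚ) / AA (N + σ)) ^ 2 /
      DD σ N := by
  rw [det_eq σ hσ, Finset.prod_div_distrib, Finset.prod_mul_distrib, pow_prod, Finset.prod_pow,
    AA_split]
  have := AA_pos (N + σ)
  congr 1
  · congr 2
    push_cast
    field_simp
  · simp [DD]

lemma prod_Icc (n : ℕ) :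
    ∏ k ∈ Finset.Icc 1 n, ((2 * k - 1).factorial : ℚ) = AA n := by
  induction n with
  | zero => simp [AA]
  | succ n ih =>
    rw [Finset.prod_Icc_succ_top (by omega), ih, AA, AA, Finset.prod_range_succ]
    push_cast
    rfl

lemma final_even (m : ℕ) :
    Matrix.det (Matrix.of fun a b : Fin m =>
      BettiEntry (2 * m) (2 * ((a : ℕ) + 1)) (2 * ((b : ℕ) + 1))) =
      (-1 : ℚ) ^ m * (2 : ℚ) ^ (-((m : ℤ) * (4 * m + 1))) *
        ((Nat.doubleFactorial (2 * m) : ℚ) / (Nat.doubleFactorial (4 * m) : ℚ)) *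
        ∏ n ∈ Finset.Icc 1 (2 * m), ((2 * n - 1).factorial : ℚ) := by
  have h := det_eq' 0 (by omega) m
  simp only [add_zero, mul_zero, zero_mul] at h
  rw [h, prod_Icc]
  have e : -((m : ℤ) * (4 * m + 1)) =
      ((2 * m ^ 2 + m : ℕ) : ℤ) - ((6 * m ^ 2 + 2 * m : ℕ) : ℤ) := by push_cast; ring
  rw [e, zpow_sub₀ (by norm_num), zpow_natCast, zpow_natCast]
  have ha : (AA (2 * m) * Nat.doubleFactorial (4 * m) : ℚ) =
    2 ^ (2 * m ^ 2 + m) * Nat.doubleFactorial (2 * m) * AA m ^ 2 * DD 0 m := by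
    exact_mod_cast arith_even m
  have h1 : (AA m : ℚ) ≠ 0 := by exact_mod_cast AA_pos m
  have h2 : (DD 0 m : ℚ) ≠ 0 := by exact_mod_cast DD_pos 0 m
  have h3 : (Nat.doubleFactorial (4 * m) : ℚ) ≠ 0 := by
    exact_mod_cast (Nat.doubleFactorial_pos (4 * m)).ne'
  have h4 : (2 : ℚ) ^ (6 * m ^ 2 + 2 * m) ≠ 0 := by positivity
  generalize (2 : ℚ) ^ (6 * m ^ 2 + 2 * m) = T at *
  generalize (2 : ℚ) ^ (2 * m ^ 2 + m) = S at *
  rw [div_pow, div_mul_div_comm, div_div,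
    show (-1 : ℚ) ^ m * (S / T) * ((Nat.doubleFactorial (2 * m) : ℚ) / Nat.doubleFactorial (4 * m)) *
      AA (2 * m) = ((-1) ^ m * S * Nat.doubleFactorial (2 * m) * AA (2 * m)) /
      (T * Nat.doubleFactorial (4 * m)) by field_simp,
    div_eq_div_iff (by positivity) (by positivity)]
  linear_combination ((-1) ^ m * AA (2 * m) * T) * ha

lemma final_odd (N : ℕ) :
    Matrix.det (Matrix.of fun a b : Fin N =>
      BettiEntry (2 * N + 1) (2 * ((a : ℕ) + 1)) (2 * ((b : ℕ) + 1))) =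
      (-1 : ℚ) ^ (N + 1 + 1) * (2 : ℚ) ^ (((5 : ℤ) - 4 * (N + 1 : ℕ)) * (N + 1 : ℕ)) *
        (∏ n ∈ Finset.Icc 1 (2 * N + 1), ((2 * n - 1).factorial : ℚ)) /
        ((Nat.doubleFactorial (2 * N + 1) : ℚ) * (Nat.doubleFactorial (4 * N + 2) : ℚ)) := by
  rw [det_eq' 1 le_rfl N, prod_Icc]
  have e : ((5 : ℤ) - 4 * (N + 1 : ℕ)) * (N + 1 : ℕ) =
      ((2 * N ^ 2 + 3 * N + 1 : ℕ) : ℤ) - ((6 * N ^ 2 + 2 * N + 4 * 1 * N : ℕ) : ℤ) := by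
    push_cast; ring
  rw [e, zpow_sub₀ (by norm_num), zpow_natCast, zpow_natCast]
  have ha : (AA (2 * N + 1) * (Nat.doubleFactorial (2 * N + 1) * Nat.doubleFactorial (4 * N + 2)) : ℚ)
    = 2 ^ (2 * N ^ 2 + 3 * N + 1) * AA (N + 1) ^ 2 * DD 1 N := by
    exact_mod_cast arith_odd N
  have h1 : (AA (N + 1) : ℚ) ≠ 0 := by exact_mod_cast AA_pos (N + 1)
  have h2 : (DD 1 N : ℚ) ≠ 0 := by exact_mod_cast DD_pos 1 N
  have h3 : (Nat.doubleFactorial (2 * N + 1) : ℚ) ≠ 0 := by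
    exact_mod_cast (Nat.doubleFactorial_pos (2 * N + 1)).ne'
  have h5 : (Nat.doubleFactorial (4 * N + 2) : ℚ) ≠ 0 := by
    exact_mod_cast (Nat.doubleFactorial_pos (4 * N + 2)).ne'
  have h4 : (2 : ℚ) ^ (6 * N ^ 2 + 2 * N + 4 * 1 * N) ≠ 0 := by positivity
  generalize (2 : ℚ) ^ (6 * N ^ 2 + 2 * N + 4 * 1 * N) = T at *
  generalize (2 : ℚ) ^ (2 * N ^ 2 + 3 * N + 1) = S at *
  rw [div_pow, div_mul_div_comm, div_div, mul_div_assoc', div_mul_eq_mul_div, div_div,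
    div_eq_div_iff (by positivity) (by positivity)]
  linear_combination ((-1) ^ N * AA (2 * N + 1) * T) * ha

end BettiAux

/-- determinants of the even-indexed Betti minors `𝔅_k^e`. -/
theorem betti_even_minor_determinants (m : ℕ) (hm : 1 ≤ m) :
    (Matrix.det
        (Matrix.of fun a b : Fin ((2 * m - 1) / 2) =>
          BettiEntry (2 * m - 1) (2 * ((a : ℕ) + 1)) (2 * ((b : ℕ) + 1))) =
      (-1 : ℚ) ^ (m + 1) * (2 : ℚ) ^ (((5 : ℤ) - 4 * m) * m) *
        (∏ n ∈ Finset.Icc 1 (2 * m - 1), ((2 * n - 1).factorial : ℚ)) /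
        ((Nat.doubleFactorial (2 * m - 1) : ℚ) * (Nat.doubleFactorial (4 * m - 2) : ℚ))) ∧
    (Matrix.det
        (Matrix.of fun a b : Fin ((2 * m) / 2) =>
          BettiEntry (2 * m) (2 * ((a : ℕ) + 1)) (2 * ((b : ℕ) + 1))) =
      (-1 : ℚ) ^ m * (2 : ℚ) ^ (-((m : ℤ) * (4 * m + 1))) *
        ((Nat.doubleFactorial (2 * m) : ℚ) / (Nat.doubleFactorial (4 * m) : ℚ)) *
        ∏ n ∈ Finset.Icc 1 (2 * m), ((2 * n - 1).factorial : ℚ)) := by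
  constructor
  · obtain ⟨N, rfl⟩ : ∃ N, m = N + 1 := ⟨m - 1, by omega⟩
    have h := BettiAux.final_odd N
    have e1 : 2 * (N + 1) - 1 = 2 * N + 1 := by omega
    have e2 : 4 * (N + 1) - 2 = 4 * N + 2 := by omega
    have e3 : (2 * N + 1) / 2 = N := by omega
    rw [e1, e2, e3]
    exact h
  · have h := BettiAux.final_even m
    have e3 : (2 * m) / 2 = m := by omega
    rw [e3]
    exact h
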